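/- Let G be a finite simple graph with m edges and let k be an integer with 1 ≤ k ≤ n⁺. Then 6·t(G) ≥ (1/√k)·(s_k(G))^(3/2) − (2m − s_k(G))^(3/2). -/

import Mathlib

/-- The adjacency matrix of a simple graph over `ℝ` is Hermitian (symmetric). -/
lemma adjMatrix_isHermitian {V : Type*} [Fintype V] (G : SimpleGraph V)
    [DecidableRel G.Adj] : (G.adjMatrix ℝ).IsHermitian := by
  rw [Matrix.IsHermitian, Matrix.conjTranspose_eq_transpose_of_trivial]
  exact G.isSymm_adjMatrix

lemma aux_trace_pow {V : Type*} [Fintype V] [DecidableEq V] {A : Matrix V V ℝ}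
    (hA : A.IsHermitian) (n : ℕ) : (A ^ n).trace = ∑ v, hA.eigenvalues v ^ n := by
  conv_lhs => rw [hA.spectral_theorem, ← map_pow, Matrix.diagonal_pow,
    Unitary.conjStarAlgAut_apply, Matrix.trace_mul_comm, ← mul_assoc]
  simp [Matrix.trace_diagonal]

lemma aux_fiber {V : Type*} [Fintype V] [DecidableEq V]
    (G : SimpleGraph V) [DecidableRel G.Adj] (s : Finset V) (hs : s ∈ G.cliqueFinset 3) :
    (((Finset.univ : Finset (V × V × V)).filter
      (fun p => G.Adj p.1 p.2.1 ∧ G.Adj p.2.1 p.2.2 ∧ G.Adj p.2.2 p.1)).filter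
      (fun p => ({p.1, p.2.1, p.2.2} : Finset V) = s)).card = 6 := by
  rw [SimpleGraph.mem_cliqueFinset_iff, SimpleGraph.is3Clique_iff] at hs
  obtain ⟨x, y, z, hxy, hxz, hyz, rfl⟩ := hs
  have h1 := hxy.ne
  have h2 := hxz.ne
  have h3 := hyz.ne
  have : (((Finset.univ : Finset (V × V × V)).filter
      (fun p => G.Adj p.1 p.2.1 ∧ G.Adj p.2.1 p.2.2 ∧ G.Adj p.2.2 p.1)).filter
      (fun p => ({p.1, p.2.1, p.2.2} : Finset V) = {x, y, z})) =
      {(x, y, z), (x, z, y), (y, x, z), (y, z, x), (z, x, y), (z, y, x)} := by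
    ext ⟨a, b, c⟩
    simp only [Finset.mem_filter, Finset.mem_univ, true_and, Finset.mem_insert,
      Finset.mem_singleton, Prod.mk.injEq]
    constructor
    · rintro ⟨⟨hab, hbc, hca⟩, h⟩
      have ha : a ∈ ({x, y, z} : Finset V) := by rw [← h]; simp
      have hb : b ∈ ({x, y, z} : Finset V) := by rw [← h]; simp
      have hc : c ∈ ({x, y, z} : Finset V) := by rw [← h]; simp
      have := hab.ne
      have := hbc.ne
      have := hca.ne
      simp only [Finset.mem_insert, Finset.mem_singleton] at ha hb hc
      clear h
      grind
    · have := hxy.symm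
      have := hxz.symm
      have := hyz.symm
      rintro (⟨rfl, rfl, rfl⟩ | ⟨rfl, rfl, rfl⟩ | ⟨rfl, rfl, rfl⟩ | ⟨rfl, rfl, rfl⟩ |
        ⟨rfl, rfl, rfl⟩ | ⟨rfl, rfl, rfl⟩) <;>
      refine ⟨⟨by assumption, by assumption, by assumption⟩, ?_⟩ <;> ext w <;> simp <;> tauto
  rw [this]
  repeat rw [Finset.card_insert_of_notMem (by simp; grind)]
  simp

lemma aux_tri {V : Type*} [Fintype V] [DecidableEq V]
    (G : SimpleGraph V) [DecidableRel G.Adj] :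
    ((G.adjMatrix ℝ) ^ 3).trace = 6 * ((G.cliqueFinset 3).card : ℝ) := by
  have h1 : ((Finset.univ : Finset (V × V × V)).filter
      (fun p => G.Adj p.1 p.2.1 ∧ G.Adj p.2.1 p.2.2 ∧ G.Adj p.2.2 p.1)).card
      = 6 * (G.cliqueFinset 3).card := by
    rw [Finset.card_eq_sum_card_fiberwise (f := fun p : V × V × V => ({p.1, p.2.1, p.2.2} : Finset V))
      (t := G.cliqueFinset 3)]
    · rw [Finset.sum_congr rfl (fun s hs => aux_fiber G s hs)]
      simp [mul_comm]
    · rintro ⟨a, b, c⟩ h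
      simp only [Finset.coe_filter, Finset.mem_univ, true_and, Set.mem_ofPred_eq] at h
      simp only [Finset.mem_coe, SimpleGraph.mem_cliqueFinset_iff,
        SimpleGraph.is3Clique_triple_iff]
      exact ⟨h.1, h.2.2.symm, h.2.1⟩
  have h2 : ((G.adjMatrix ℝ) ^ 3).trace = ∑ p : V × V × V,
      if (G.Adj p.1 p.2.1 ∧ G.Adj p.2.1 p.2.2 ∧ G.Adj p.2.2 p.1) then (1 : ℝ) else 0 := by
    rw [pow_succ', pow_two]
    simp only [Matrix.trace, Matrix.diag, Matrix.mul_apply, Fintype.sum_prod_type,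
      Finset.mul_sum, SimpleGraph.adjMatrix_apply]
    refine Finset.sum_congr rfl fun a _ => Finset.sum_congr rfl fun b _ =>
      Finset.sum_congr rfl fun c _ => ?_
    by_cases h1 : G.Adj a b <;> by_cases h2 : G.Adj b c <;> by_cases h3 : G.Adj c a <;>
      simp [h1, h2, h3]
  rw [h2, Finset.sum_boole, h1]
  push_cast
  ring

lemma aux_edge {V : Type*} [Fintype V] [DecidableEq V]
    (G : SimpleGraph V) [DecidableRel G.Adj] :
    ((G.adjMatrix ℝ) ^ 2).trace = 2 * (G.edgeFinset.card : ℝ) := by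
  rw [pow_two]
  simp only [Matrix.trace, Matrix.diag, SimpleGraph.adjMatrix_mul_self_apply_self]
  exact_mod_cast G.sum_degrees_eq_twice_card_edges

lemma aux_sq_rpow (x : ℝ) : (x ^ 2) ^ ((3 : ℝ) / 2) = |x| ^ 3 := by
  rw [← sq_abs, ← Real.rpow_natCast, ← Real.rpow_mul (abs_nonneg x), ← Real.rpow_natCast]
  norm_num

lemma aux_rest {ι : Type*} (s : Finset ι) (f : ι → ℝ) :
    - (∑ i ∈ s, f i ^ 2) ^ ((3 : ℝ) / 2) ≤ ∑ i ∈ s, f i ^ 3 := by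
  set S := ∑ i ∈ s, f i ^ 2 with hS
  have hS0 : 0 ≤ S := Finset.sum_nonneg fun i _ => sq_nonneg _
  have e : S ^ ((3 : ℝ) / 2) = Real.sqrt S * S := by
    have h := aux_sq_rpow (Real.sqrt S)
    rw [Real.sq_sqrt hS0, abs_of_nonneg (Real.sqrt_nonneg _)] at h
    rw [h, pow_succ', Real.sq_sqrt hS0]
  rw [e, neg_le, ← Finset.sum_neg_distrib]
  calc ∑ i ∈ s, - f i ^ 3 ≤ ∑ i ∈ s, Real.sqrt S * f i ^ 2 := by
        refine Finset.sum_le_sum fun i hi => ?_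
        have h1 : |f i| ≤ Real.sqrt S := by
          apply Real.abs_le_sqrt
          exact Finset.single_le_sum (f := fun i => f i ^ 2) (fun i _ => sq_nonneg _) hi
        nlinarith [neg_abs_le (f i), sq_nonneg (f i)]
    _ = _ := by rw [← Finset.mul_sum]

lemma aux_head {ι : Type*} (s : Finset ι) (f : ι → ℝ) (hf : ∀ i ∈ s, 0 ≤ f i)
    (k : ℕ) (hk : 1 ≤ k) (hs : s.card = k) :
    (1 / Real.sqrt k) * (∑ i ∈ s, f i ^ 2) ^ ((3 : ℝ) / 2) ≤ ∑ i ∈ s, f i ^ 3 := by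
  have h := Real.rpow_sum_le_const_mul_sum_rpow_of_nonneg s (f := fun i => f i ^ 2)
    (p := (3 : ℝ) / 2) (by norm_num) (fun i _ => sq_nonneg _)
  rw [hs, Finset.sum_congr rfl (fun i hi => (aux_sq_rpow (f i)).trans
    (by rw [abs_of_nonneg (hf i hi)])), show (3 : ℝ) / 2 - 1 = 1 / 2 by norm_num,
    ← Real.sqrt_eq_rpow] at h
  have hk0 : (0 : ℝ) < Real.sqrt k := Real.sqrt_pos.2 (by exact_mod_cast hk)
  rw [one_div, inv_mul_le_iff₀ hk0]
  exact h

/-- **Lemma on triangle counts via eigenvalues.**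
For a graph `G` with `m` edges, eigenvalues `μ 0 ≥ μ 1 ≥ ⋯` of its adjacency matrix,
and any `k` with `1 ≤ k ≤ n⁺` (the number of positive eigenvalues),
`6·t(G) ≥ (1/√k)·(s_k)^(3/2) − (2m − s_k)^(3/2)` where `s_k = ∑_{i<k} μ i ^ 2`. -/
theorem stmt_3 {V : Type*} [Fintype V] [DecidableEq V]
    (G : SimpleGraph V) [DecidableRel G.Adj]
    (m : ℕ) (hm : G.edgeFinset.card = m)
    (μ : Fin (Fintype.card V) → ℝ) (hanti : Antitone μ)
    (hμ : ∃ e : V ≃ Fin (Fintype.card V),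
      ∀ v, (adjMatrix_isHermitian G).eigenvalues v = μ (e v))
    (k : ℕ) (hk1 : 1 ≤ k)
    (hk2 : k ≤ (Finset.univ.filter fun i => 0 < μ i).card) :
    6 * ((G.cliqueFinset 3).card : ℝ) ≥
      (1 / Real.sqrt k) *
        (∑ i ∈ Finset.univ.filter (fun i : Fin (Fintype.card V) => (i : ℕ) < k),
          μ i ^ 2) ^ ((3 : ℝ) / 2)
      - (2 * (m : ℝ) -
          ∑ i ∈ Finset.univ.filter (fun i : Fin (Fintype.card V) => (i : ℕ) < k),
            μ i ^ 2) ^ ((3 : ℝ) / 2) := by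
  obtain ⟨e, he⟩ := hμ
  have hsum : ∀ n : ℕ, ∑ i, μ i ^ n = ((G.adjMatrix ℝ) ^ n).trace := by
    intro n
    rw [aux_trace_pow (adjMatrix_isHermitian G), ← e.sum_comp]
    simp [he]
  have h2 := (hsum 2).trans (aux_edge G)
  have h3 := (hsum 3).trans (aux_tri G)
  rw [hm] at h2
  have hkn : k ≤ Fintype.card V := by
    exact hk2.trans ((Finset.card_le_univ _).trans (Fintype.card_fin _).le)
  have hcard : (Finset.univ.filter (fun i : Fin (Fintype.card V) => (i : ℕ) < k)).card = k := by
    rw [Fin.card_filter_val_lt]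
    exact min_eq_right hkn
  have hpos : ∀ i ∈ Finset.univ.filter (fun i : Fin (Fintype.card V) => (i : ℕ) < k),
      0 ≤ μ i := by
    intro i hi
    simp only [Finset.mem_filter, Finset.mem_univ, true_and] at hi
    by_contra hneg
    push Not at hneg
    have hsub : (Finset.univ.filter fun j => 0 < μ j) ⊆ Finset.Iio i := by
      intro j hj
      simp only [Finset.mem_filter, Finset.mem_univ, true_and] at hj
      rw [Finset.mem_Iio]
      by_contra hij
      have := hanti (not_lt.1 hij)
      linarith
    have := Finset.card_le_card hsub
    rw [Fin.card_Iio] at this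
    omega
  have hh := aux_head _ μ hpos k hk1 hcard
  have hr := aux_rest (Finset.univ.filter (fun i : Fin (Fintype.card V) => ¬ (i : ℕ) < k)) μ
  have e2 := Finset.sum_filter_add_sum_filter_not Finset.univ
    (fun i : Fin (Fintype.card V) => (i : ℕ) < k) (fun i => μ i ^ 2)
  have e3 := Finset.sum_filter_add_sum_filter_not Finset.univ
    (fun i : Fin (Fintype.card V) => (i : ℕ) < k) (fun i => μ i ^ 3)
  rw [h2] at e2
  rw [h3] at e3
  rw [← e2, add_sub_cancel_left, ← e3]
  linarith
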